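/- Let σ ∈ {1,2} and assume Σ_{x∈ℤ}⟨x⟩^σ(|α(x)−α₀| + |θ(x)|) < ∞. Then Jost solutions φ±(·,ξ) exist for all ξ ∈ ℝ and can be chosen so that for each fixed x ∈ ℤ the map ξ ↦ m±(x,ξ) := e^{∓iξx}φ±(x,ξ) is a continuous 2π-periodic function of ξ whose Fourier coefficients m̂±(x,n) := (2π)⁻¹∫_{−π}^{π} m±(x,ξ)e^{−inξ}dξ satisfy Σ_{n∈ℤ} ⟨n⟩^{σ−1}·‖m̂±(x,n)‖ ≤ C·max(1, ∓x)^σ for all x ∈ ℤ, with C independent of x. -/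

import Mathlib

open Complex Matrix

noncomputable section

/-- The coin matrix `C_{α,β,θ} = e^{iθ}[[β, conj α],[−α, conj β]]`. -/
def coinMat (a b : ℂ) (t : ℝ) : Matrix (Fin 2) (Fin 2) ℂ :=
  Complex.exp ((t : ℂ) * Complex.I) • !![b, (starRingEnd ℂ) a; -a, (starRingEnd ℂ) b]

/-- The quantum walk evolution operator `U = SĈ`, acting on arbitrary `u : ℤ → ℂ²`:
`(Uu)↑(x) = (C(x−1)u(x−1))↑`, `(Uu)↓(x) = (C(x+1)u(x+1))↓`. -/
def qw (C : ℤ → Matrix (Fin 2) (Fin 2) ℂ) (u : ℤ → Fin 2 → ℂ) : ℤ → Fin 2 → ℂ :=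
  fun x => ![(C (x - 1)).mulVec (u (x - 1)) 0, (C (x + 1)).mulVec (u (x + 1)) 1]

/-- `ρ = √(1−|a|²)`. -/
def rho (a : ℂ) : ℝ := Real.sqrt (1 - ‖a‖ ^ 2)

/-- The coin map `x ↦ C_{α(x), ρ(x), θ(x)}`. -/
def coinOf (α : ℤ → ℂ) (θ : ℤ → ℝ) : ℤ → Matrix (Fin 2) (Fin 2) ℂ :=
  fun x => coinMat (α x) ((rho (α x) : ℝ) : ℂ) (θ x)

/-- The transfer matrix `T_λ(x)`. -/
def Tmat (α : ℤ → ℂ) (θ : ℤ → ℝ) (lam : ℂ) (x : ℤ) : Matrix (Fin 2) (Fin 2) ℂ :=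
  (((rho (α x) : ℝ) : ℂ))⁻¹ •
    !![Complex.exp (Complex.I * (lam - (θ x : ℂ))), α x;
       (starRingEnd ℂ) (α x), Complex.exp (-(Complex.I * (lam - (θ x : ℂ))))]

/-- `(J_VE u)(x) = (u↓(x−1), u↑(x))`. -/
def Jve (u : ℤ → Fin 2 → ℂ) : ℤ → Fin 2 → ℂ := fun x => ![u (x - 1) 1, u x 0]

/-- `(J_EV v)(x) = (v↓(x), v↑(x+1))`, the inverse of `J_VE`. -/
def Jev (v : ℤ → Fin 2 → ℂ) : ℤ → Fin 2 → ℂ := fun x => ![v x 1, v (x + 1) 0]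

/-- Determinant of the 2×2 matrix with columns `v, w`. -/
def det2 (v w : Fin 2 → ℂ) : ℂ := v 0 * w 1 - v 1 * w 0

/-- The Euclidean norm on ℂ². -/
def nrm2 (v : Fin 2 → ℂ) : ℝ := Real.sqrt (‖v 0‖ ^ 2 + ‖v 1‖ ^ 2)

/-- Membership in `l²(ℤ, ℂ²)`. -/
def MemL2 (u : ℤ → Fin 2 → ℂ) : Prop := Summable fun x : ℤ => ‖u x 0‖ ^ 2 + ‖u x 1‖ ^ 2

/-- The Japanese bracket `⟨x⟩ = √(1+x²)`. -/
def jp (x : ℤ) : ℝ := Real.sqrt (1 + (x : ℝ) ^ 2)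

/-- The free transfer matrix `T_{0,λ}` (for real `λ`). -/
def T0m (a0 : ℂ) (lam : ℝ) : Matrix (Fin 2) (Fin 2) ℂ :=
  (((rho a0 : ℝ) : ℂ))⁻¹ •
    !![Complex.exp (Complex.I * (lam : ℂ)), a0;
       (starRingEnd ℂ) a0, Complex.exp (-(Complex.I * (lam : ℂ)))]

/-- `λ(ξ) = arccos(ρ₀ cos ξ) ∈ [0,π]`. -/
def lamOf (a0 : ℂ) (ξ : ℝ) : ℝ := Real.arccos (rho a0 * Real.cos ξ)

/-- `A_{ξ,±} = e^{∓iξ}T_{0,λ(ξ)}`; `ε = 1` is the `+` case, `ε = −1` the `−` case. -/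
def Amat (a0 : ℂ) (ε : ℝ) (ξ : ℝ) : Matrix (Fin 2) (Fin 2) ℂ :=
  Complex.exp (-(((ε * ξ : ℝ) : ℂ) * Complex.I)) • T0m a0 (lamOf a0 ξ)

/-- Integer powers of a matrix: for negative exponents, powers of the inverse matrix. -/
def mzpow (A : Matrix (Fin 2) (Fin 2) ℂ) (x : ℤ) : Matrix (Fin 2) (Fin 2) ℂ :=
  if 0 ≤ x then A ^ x.toNat else A⁻¹ ^ (-x).toNat

/-- The operator norm on `ℂ²` of a 2×2 matrix. -/
def opN (A : Matrix (Fin 2) (Fin 2) ℂ) : ℝ := ‖Matrix.toEuclideanCLM (𝕜 := ℂ) A‖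

/-- `A_±(ξ) = |α₀|² + |e^{iλ(ξ)} − ρ₀e^{±iξ}|²`; `ε = ±1`. -/
def Aco (a0 : ℂ) (ε : ℝ) (ξ : ℝ) : ℝ :=
  ‖a0‖ ^ 2 + ‖Complex.exp (Complex.I * (lamOf a0 ξ : ℂ))
      - ((rho a0 : ℝ) : ℂ) * Complex.exp (((ε * ξ : ℝ) : ℂ) * Complex.I)‖ ^ 2

/-- The unit eigenvector `φ_±(ξ) = A_±(ξ)^{−1/2}(−α₀, e^{iλ(ξ)} − ρ₀e^{±iξ})ᵀ`; `ε = ±1`. -/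
def jvec (a0 : ℂ) (ε : ℝ) (ξ : ℝ) : Fin 2 → ℂ :=
  (((Real.sqrt (Aco a0 ε ξ))⁻¹ : ℝ) : ℂ) •
    ![-a0, Complex.exp (Complex.I * (lamOf a0 ξ : ℂ))
        - ((rho a0 : ℝ) : ℂ) * Complex.exp (((ε * ξ : ℝ) : ℂ) * Complex.I)]

/-- `φ` is a Jost solution `φ₊(·,ξ)`: solves the transfer recursion at `λ(ξ)` and
`e^{−iξx}φ(x) → φ₊(ξ)` as `x → +∞`. -/
def IsJostP (α : ℤ → ℂ) (θ : ℤ → ℝ) (a0 : ℂ) (ξ : ℝ) (φ : ℤ → Fin 2 → ℂ) : Prop :=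
  (∀ x : ℤ, φ (x + 1) = (Tmat α θ ((lamOf a0 ξ : ℝ) : ℂ) x).mulVec (φ x)) ∧
  Filter.Tendsto
    (fun x : ℤ => fun i : Fin 2 => Complex.exp (-(((ξ * x : ℝ) : ℂ) * Complex.I)) * φ x i)
    Filter.atTop (nhds (jvec a0 1 ξ))

/-- `φ` is a Jost solution `φ₋(·,ξ)`: solves the transfer recursion at `λ(ξ)` and
`e^{iξx}φ(x) → φ₋(ξ)` as `x → −∞`. -/
def IsJostM (α : ℤ → ℂ) (θ : ℤ → ℝ) (a0 : ℂ) (ξ : ℝ) (φ : ℤ → Fin 2 → ℂ) : Prop :=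
  (∀ x : ℤ, φ (x + 1) = (Tmat α θ ((lamOf a0 ξ : ℝ) : ℂ) x).mulVec (φ x)) ∧
  Filter.Tendsto
    (fun x : ℤ => fun i : Fin 2 => Complex.exp (((ξ * x : ℝ) : ℂ) * Complex.I) * φ x i)
    Filter.atBot (nhds (jvec a0 (-1) ξ))

/-- The `n`-th Fourier coefficient of a 2π-periodic `ℂ²`-valued function, entrywise. -/
def fcoefV (f : ℝ → Fin 2 → ℂ) (n : ℤ) : Fin 2 → ℂ := fun i =>
  ((2 * Real.pi : ℝ) : ℂ)⁻¹ *
    ∫ ξ in (-Real.pi)..Real.pi, f ξ i * Complex.exp (-((n : ℂ) * (ξ : ℂ) * Complex.I))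

/-- The ordered product `S x * S (x + 1) * ⋯ * S (x + k - 1)`. -/
def orderedProd {R : Type*} [Monoid R] (S : ℤ → R) : ℕ → ℤ → R
  | 0, _ => 1
  | k + 1, x => S x * orderedProd S k (x + 1)

lemma sub_add_one_le_two_mul_max (x y : ℝ) :
    y - x + 1 ≤ 2 * (max 1 (-x) * max 1 (y + 1)) := by
  have h1 : 1 ≤ max 1 (-x) := le_max_left _ _
  have h2 : -x ≤ max 1 (-x) := le_max_right _ _
  have h3 : 1 ≤ max 1 (y + 1) := le_max_left _ _
  have h4 : y + 1 ≤ max 1 (y + 1) := le_max_right _ _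
  nlinarith [mul_nonneg (sub_nonneg.2 h1) (sub_nonneg.2 h3)]

lemma max_mul_max_le (y : ℝ) : max 1 (y + 1) * max 1 (-(y + 1)) ≤ 1 + |y| := by
  rcases le_total 0 (y + 1) with h | h
  · rw [max_eq_left (a := (1 : ℝ)) (b := -(y + 1)) (by linarith), mul_one]
    exact max_le (by linarith [abs_nonneg y]) (by linarith [le_abs_self y])
  · rw [max_eq_left (a := (1 : ℝ)) (b := y + 1) (by linarith), one_mul]
    exact max_le (by linarith [abs_nonneg y]) (by linarith [neg_le_abs y])

lemma norm_pow_mul_orderedProd_le {R : Type*} [NormedRing R] (B : R) (V : ℤ → R)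
    (σ : ℕ) (c : ℝ) (hc : 0 ≤ c)
    (hB : ∀ (x : ℤ) (l : ℕ), ‖B ^ l‖ ≤ c * (max 1 (-((x - l : ℤ) : ℝ)) * max 1 ((x : ℝ) + 1)) ^ σ)
    (k l : ℕ) (x : ℤ) :
    ‖B ^ l * orderedProd (fun y => B + V y) k x‖ ≤
      c * (max 1 (-((x - l : ℤ) : ℝ)) * max 1 (((x + k : ℤ) : ℝ) + 1)) ^ σ *
        ∏ j ∈ Finset.range k, (1 + c * ((1 + |((x + j : ℤ) : ℝ)|) ^ σ * ‖V (x + j)‖)) := by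
  induction k generalizing l x with
  | zero => simpa [orderedProd] using hB x l
  | succ k ih =>
    rw [Finset.prod_range_succ']
    have e : B ^ l * orderedProd (fun y => B + V y) (k + 1) x =
        B ^ (l + 1) * orderedProd (fun y => B + V y) k (x + 1) +
          B ^ l * V x * (B ^ 0 * orderedProd (fun y => B + V y) k (x + 1)) := by
      simp only [orderedProd, pow_succ, pow_zero]; noncomm_ring
    have i1 := ih (l + 1) (x + 1)
    have i2 := ih 0 (x + 1)
    have hP : ∀ j : ℕ, x + 1 + (j : ℤ) = x + ((j + 1 : ℕ) : ℤ) := by intro j; push_cast; ring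
    have hl : x + 1 - ((l + 1 : ℕ) : ℤ) = x - l := by push_cast; ring
    simp only [hP, hl] at i1 i2
    simp only [Nat.cast_zero, sub_zero, add_zero] at i2 ⊢
    set p := ∏ j ∈ Finset.range k,
      (1 + c * ((1 + |((x + ((j + 1 : ℕ) : ℤ) : ℤ) : ℝ)|) ^ σ * ‖V (x + ((j + 1 : ℕ) : ℤ))‖))
    have hp : 0 ≤ p := Finset.prod_nonneg fun j _ => by positivity
    set W := max 1 (-((x - l : ℤ) : ℝ))
    have hW : 0 ≤ W := le_trans zero_le_one (le_max_left _ _)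
    set N := max 1 (((x + ((k + 1 : ℕ) : ℤ) : ℤ) : ℝ) + 1)
    have hN : 0 ≤ N := le_trans zero_le_one (le_max_left _ _)
    have h0 := hB x l
    have hm := max_mul_max_le (x : ℝ)
    have hb : (0 : ℝ) ≤ max 1 ((x : ℝ) + 1) := le_trans zero_le_one (le_max_left _ _)
    have hb' : (0 : ℝ) ≤ max 1 (-((x : ℝ) + 1)) := le_trans zero_le_one (le_max_left _ _)
    push_cast at i2
    calc _ ≤ ‖B ^ (l + 1) * orderedProd (fun y => B + V y) k (x + 1)‖ +
          ‖B ^ l‖ * ‖V x‖ * ‖B ^ 0 * orderedProd (fun y => B + V y) k (x + 1)‖ := by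
          rw [e]
          refine (norm_add_le _ _).trans (add_le_add le_rfl ((norm_mul_le _ _).trans ?_))
          gcongr
          exact norm_mul_le _ _
      _ ≤ c * (W * N) ^ σ * p + (c * (W * max 1 ((x : ℝ) + 1)) ^ σ) * ‖V x‖ *
          (c * (max 1 (-((x : ℝ) + 1)) * N) ^ σ * p) := by
          gcongr
      _ = c * (W * N) ^ σ * p * (1 + c * ((max 1 ((x : ℝ) + 1) * max 1 (-((x : ℝ) + 1))) ^ σ *
            ‖V x‖)) := by
          simp only [mul_pow]; ring
      _ ≤ c * (W * N) ^ σ * p * (1 + c * ((1 + |(x : ℝ)|) ^ σ * ‖V x‖)) := by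
          gcongr
      _ = _ := by ring

theorem exists_solution_of_summable_perturbation {E : Type*} [NormedAddCommGroup E]
    [NormedSpace ℂ E] [CompleteSpace E] (B : E →L[ℂ] E) (V : ℤ → E →L[ℂ] E) (v : E)
    (hv : B v = v) (σ : ℕ) (c : ℝ) (hB : ∀ k : ℕ, ‖B ^ k‖ ≤ c * ((k : ℝ) + 1) ^ σ)
    (hV : Summable fun x : ℤ => (1 + |(x : ℝ)|) ^ σ * ‖V x‖) :
    ∃ u : ℤ → E, (∀ x, u x = (B + V x) (u (x + 1))) ∧
      Filter.Tendsto u Filter.atTop (nhds v) ∧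
      ∃ C : ℝ, 0 ≤ C ∧ ∀ x : ℤ, ‖u x‖ ≤ C * max 1 (-(x : ℝ)) ^ σ := by
  have hc : 0 ≤ c := by
    have := (norm_nonneg _).trans (hB 0)
    simpa using this
  set c' : ℝ := c * 2 ^ σ with hc'
  have hc'0 : 0 ≤ c' := by positivity
  have hB' : ∀ (x : ℤ) (l : ℕ),
      ‖B ^ l‖ ≤ c' * (max 1 (-((x - l : ℤ) : ℝ)) * max 1 ((x : ℝ) + 1)) ^ σ := by
    intro x l
    refine (hB l).trans ?_
    rw [hc', mul_assoc, ← mul_pow]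
    gcongr
    have := sub_add_one_le_two_mul_max ((x - l : ℤ) : ℝ) (x : ℝ)
    push_cast at this ⊢
    linarith
  set K : ℝ := Real.exp (∑' x : ℤ, c' * ((1 + |(x : ℝ)|) ^ σ * ‖V x‖))
  have hP : ∀ (k : ℕ) (x : ℤ), ‖orderedProd (fun y => B + V y) k x‖ ≤
      c' * K * (max 1 (-(x : ℝ)) ^ σ * max 1 (((x + k : ℤ) : ℝ) + 1) ^ σ) := by
    intro k x
    have h := norm_pow_mul_orderedProd_le B V σ c' hc'0 hB' k 0 x
    simp only [pow_zero, one_mul, Nat.cast_zero, sub_zero] at h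
    refine h.trans ?_
    have hprod : ∏ j ∈ Finset.range k,
        (1 + c' * ((1 + |((x + j : ℤ) : ℝ)|) ^ σ * ‖V (x + j)‖)) ≤ K := by
      calc _ ≤ ∏ j ∈ Finset.range k,
            Real.exp (c' * ((1 + |((x + j : ℤ) : ℝ)|) ^ σ * ‖V (x + j)‖)) := by
            refine Finset.prod_le_prod (fun j _ => by positivity) fun j _ => ?_
            rw [add_comm]; exact Real.add_one_le_exp _
        _ = Real.exp (∑ j ∈ Finset.range k, c' * ((1 + |((x + j : ℤ) : ℝ)|) ^ σ * ‖V (x + j)‖)) :=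
            (Real.exp_sum _ _).symm
        _ ≤ K := by
            refine Real.exp_le_exp.2 ?_
            have hs := hV.mul_left c'
            have hi : Function.Injective fun j : ℕ => x + (j : ℤ) := fun a b h => by simpa using h
            refine ((hs.comp_injective hi).sum_le_tsum _ fun j _ => ?_).trans
              (tsum_comp_le_tsum_of_inj hs (fun y => by positivity) hi)
            simp only [Function.comp]; positivity
    calc _ ≤ c' * (max 1 (-(x : ℝ)) * max 1 (((x + k : ℤ) : ℝ) + 1)) ^ σ * K := by gcongr
      _ = _ := by rw [mul_pow]; ring
  have hterm : ∀ (x : ℤ) (k : ℕ), ‖orderedProd (fun y => B + V y) k x (V (x + k) v)‖ ≤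
      c' * K * max 1 (-(x : ℝ)) ^ σ * ‖v‖ *
        ((1 + |((x + k : ℤ) : ℝ)|) ^ σ * ‖V (x + k)‖) := by
    intro x k
    have hb : max 1 (((x + k : ℤ) : ℝ) + 1) ≤ 1 + |((x + k : ℤ) : ℝ)| :=
      max_le (by linarith [abs_nonneg ((x + k : ℤ) : ℝ)])
        (by linarith [le_abs_self ((x + k : ℤ) : ℝ)])
    calc _ ≤ ‖orderedProd (fun y => B + V y) k x‖ * (‖V (x + k)‖ * ‖v‖) :=
          (ContinuousLinearMap.le_opNorm _ _).trans
            (by gcongr; exact ContinuousLinearMap.le_opNorm _ _)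
      _ ≤ c' * K * (max 1 (-(x : ℝ)) ^ σ * (1 + |((x + k : ℤ) : ℝ)|) ^ σ) *
            (‖V (x + k)‖ * ‖v‖) := by
          gcongr
          exact (hP k x).trans (by gcongr)
      _ = _ := by ring
  have hinj : ∀ x : ℤ, Function.Injective fun j : ℕ => x + (j : ℤ) :=
    fun x a b h => by simpa using h
  have hVs : ∀ x : ℤ, Summable fun k : ℕ => (1 + |((x + k : ℤ) : ℝ)|) ^ σ * ‖V (x + k)‖ :=
    fun x => hV.comp_injective (hinj x)
  have hsum : ∀ x : ℤ, Summable fun k : ℕ => orderedProd (fun y => B + V y) k x (V (x + k) v) :=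
    fun x => Summable.of_norm_bounded ((hVs x).mul_left _) (hterm x)
  have hdiff : ∀ x : ℤ, ‖∑' k : ℕ, orderedProd (fun y => B + V y) k x (V (x + k) v)‖ ≤
      c' * K * max 1 (-(x : ℝ)) ^ σ * ‖v‖ *
        ∑' k : ℕ, (1 + |((x + k : ℤ) : ℝ)|) ^ σ * ‖V (x + k)‖ := fun x => by
    rw [← tsum_mul_left]
    exact tsum_of_norm_bounded ((hVs x).mul_left _).hasSum (hterm x)
  refine ⟨fun x => v + ∑' k : ℕ, orderedProd (fun y => B + V y) k x (V (x + k) v), ?_, ?_, ?_⟩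
  · intro x
    beta_reduce
    rw [(hsum x).tsum_eq_zero_add, map_add, ContinuousLinearMap.map_tsum _ (hsum (x + 1))]
    simp only [orderedProd, mul_apply_eq_comp, Nat.cast_zero, add_zero,
      _root_.add_apply, hv, one_apply_eq_self, Nat.cast_add, Nat.cast_one,
      add_assoc, add_comm (1 : ℤ)]
  · have ht : Filter.Tendsto (fun x : ℤ => ∑' k : ℕ,
        (1 + |((x + k : ℤ) : ℝ)|) ^ σ * ‖V (x + k)‖) Filter.atTop (nhds 0) := by
      have h1 : Filter.Tendsto (fun n : ℕ => ∑' k : ℕ,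
        (1 + |((k + n : ℕ) : ℝ)|) ^ σ * ‖V ((k + n : ℕ) : ℤ)‖) Filter.atTop (nhds 0) :=
        tendsto_sum_nat_add fun k : ℕ => (1 + |((k : ℕ) : ℝ)|) ^ σ * ‖V (k : ℤ)‖
      have h2 : Filter.Tendsto Int.toNat Filter.atTop Filter.atTop :=
        Filter.tendsto_atTop.2 fun n => (Filter.eventually_ge_atTop (n : ℤ)).mono fun x hx => by omega
      refine (h1.comp h2).congr' ?_
      filter_upwards [Filter.eventually_ge_atTop (0 : ℤ)] with x hx
      simp only [Function.comp]
      refine tsum_congr fun k => ?_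
      have h3 : ((k + x.toNat : ℕ) : ℤ) = x + k := by push_cast; omega
      rw [← h3, Int.cast_natCast]
    have hz : Filter.Tendsto (fun x : ℤ => ∑' k : ℕ,
        orderedProd (fun y => B + V y) k x (V (x + k) v)) Filter.atTop (nhds 0) := by
      refine squeeze_zero_norm' ?_ (by simpa using ht.const_mul (c' * K * ‖v‖))
      filter_upwards [Filter.eventually_ge_atTop (0 : ℤ)] with x hx
      have hx' : (0 : ℝ) ≤ x := by exact_mod_cast hx
      have h := hdiff x
      rw [max_eq_left (by linarith)] at h
      simpa using h
    simpa using hz.const_add v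
  · set Q : ℝ := ∑' x : ℤ, (1 + |(x : ℝ)|) ^ σ * ‖V x‖
    have hS : 0 ≤ Q := tsum_nonneg fun x => by positivity
    refine ⟨‖v‖ + c' * K * ‖v‖ * Q, by positivity, fun x => ?_⟩
    have h1 : ∑' k : ℕ, (1 + |((x + k : ℤ) : ℝ)|) ^ σ * ‖V (x + k)‖ ≤ Q :=
      tsum_comp_le_tsum_of_inj hV (fun y => by positivity) (hinj x)
    have h2 : (1 : ℝ) ≤ max 1 (-(x : ℝ)) ^ σ := one_le_pow₀ (le_max_left _ _)
    calc _ ≤ ‖v‖ + c' * K * max 1 (-(x : ℝ)) ^ σ * ‖v‖ * Q :=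
          (norm_add_le _ _).trans (add_le_add le_rfl ((hdiff x).trans (by gcongr)))
      _ ≤ ‖v‖ * max 1 (-(x : ℝ)) ^ σ + c' * K * max 1 (-(x : ℝ)) ^ σ * ‖v‖ * Q := by
          gcongr
          exact le_mul_of_one_le_right (norm_nonneg _) h2
      _ = _ := by ring

/-- The submultiplicative weight `(1 + |n|) ^ s` on `ℤ`. -/
def wt (s : ℕ) (n : ℤ) : ℝ := (1 + |(n : ℝ)|) ^ s

lemma wt_pos (s : ℕ) (n : ℤ) : 0 < wt s n := by unfold wt; positivity

lemma one_le_wt (s : ℕ) (n : ℤ) : 1 ≤ wt s n :=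
  one_le_pow₀ (by linarith [abs_nonneg (n : ℝ)])

lemma wt_le_mul_wt_sub (s : ℕ) (n j : ℤ) : wt s n ≤ wt s j * wt s (n - j) := by
  unfold wt
  rw [← mul_pow]
  refine pow_le_pow_left₀ (by positivity) ?_ s
  have h : |(n : ℝ)| ≤ |(j : ℝ)| + |((n - j : ℤ) : ℝ)| := by
    simpa using abs_add_le (j : ℝ) ((n - j : ℤ) : ℝ)
  nlinarith [abs_nonneg (j : ℝ), abs_nonneg ((n - j : ℤ) : ℝ),
    mul_nonneg (abs_nonneg (j : ℝ)) (abs_nonneg ((n - j : ℤ) : ℝ))]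

/-- Absolutely summable `ℂ²`-valued sequences. An element `g` stands for the trigonometric series
with coefficients `(wt s n)⁻¹ • g n`, so that its norm is the `wt s`-weighted Wiener norm. -/
abbrev SeqSpace := lp (fun _ : ℤ => Fin 2 → ℂ) 1

lemma memℓp_one_iff {V : Type*} [NormedAddCommGroup V] {f : ℤ → V} :
    Memℓp f 1 ↔ Summable fun n => ‖f n‖ := by
  simpa using memℓp_gen_iff (p := 1) (f := f) (by simp)

lemma summable_norm_seq (g : SeqSpace) : Summable fun n => ‖g n‖ :=
  memℓp_one_iff.1 (lp.memℓp g)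

lemma norm_eq_tsum_seq (g : SeqSpace) : ‖g‖ = ∑' n, ‖g n‖ := by
  simpa using lp.norm_eq_tsum_rpow (p := 1) (by simp) g

lemma norm_weighted_shift_le (s : ℕ) (j : ℤ) (A : (Fin 2 → ℂ) →L[ℂ] (Fin 2 → ℂ)) (g : ℤ → Fin 2 → ℂ)
    (n : ℤ) :
    ‖((wt s n / wt s (n - j) : ℝ) : ℂ) • A (g (n - j))‖ ≤ wt s j * ‖A‖ * ‖g (n - j)‖ := by
  rw [norm_smul, Complex.norm_real, Real.norm_of_nonneg (div_pos (wt_pos _ _) (wt_pos _ _)).le,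
    mul_assoc]
  gcongr
  · exact (wt_pos _ _).le
  · rw [div_le_iff₀ (wt_pos _ _)]; exact wt_le_mul_wt_sub s n j
  · exact A.le_opNorm _

lemma summable_norm_comp_sub (g : SeqSpace) (j : ℤ) : Summable fun n => ‖g (n - j)‖ :=
  (summable_norm_seq g).comp_injective (sub_left_injective (b := j))

/-- Multiplication by `ξ ↦ e^{ijξ} A` on trigonometric series. -/
def shiftMap (s : ℕ) (j : ℤ) (A : (Fin 2 → ℂ) →L[ℂ] (Fin 2 → ℂ)) : SeqSpace →L[ℂ] SeqSpace :=
  LinearMap.mkContinuous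
    { toFun := fun g => ⟨fun n => ((wt s n / wt s (n - j) : ℝ) : ℂ) • A (g (n - j)),
        memℓp_one_iff.2 (Summable.of_nonneg_of_le (fun _ => norm_nonneg _)
          (norm_weighted_shift_le s j A g) ((summable_norm_comp_sub g j).mul_left _))⟩
      map_add' := fun g h => by
        ext n : 2
        simp only [lp.coeFn_add, Pi.add_apply, map_add, smul_add]
      map_smul' := fun c g => by
        ext n : 2
        simp only [lp.coeFn_smul, Pi.smul_apply, map_smul, RingHom.id_apply]
        rw [smul_comm] }
    (wt s j * ‖A‖) fun g => by
      rw [norm_eq_tsum_seq, norm_eq_tsum_seq,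
        ← (Equiv.subRight j).tsum_eq (fun n => ‖g n‖), ← tsum_mul_left]
      have h := (summable_norm_comp_sub g j).mul_left (wt s j * ‖A‖)
      exact Summable.tsum_le_tsum (norm_weighted_shift_le s j A g)
        (Summable.of_nonneg_of_le (fun _ => norm_nonneg _) (norm_weighted_shift_le s j A g) h) h

lemma shiftMap_apply (s : ℕ) (j : ℤ) (A : (Fin 2 → ℂ) →L[ℂ] (Fin 2 → ℂ)) (g : SeqSpace) (n : ℤ) :
    shiftMap s j A g n = ((wt s n / wt s (n - j) : ℝ) : ℂ) • A (g (n - j)) := rfl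

lemma norm_shiftMap_le (s : ℕ) (j : ℤ) (A : (Fin 2 → ℂ) →L[ℂ] (Fin 2 → ℂ)) :
    ‖shiftMap s j A‖ ≤ wt s j * ‖A‖ :=
  LinearMap.mkContinuous_norm_le _ (mul_nonneg (wt_pos _ _).le (norm_nonneg _)) _

lemma norm_series_term_le (s : ℕ) (ξ : ℝ) (g : SeqSpace) (n : ℤ) :
    ‖(((wt s n)⁻¹ : ℝ) : ℂ) • Complex.exp (n * ξ * I) • g n‖ ≤ ‖g n‖ := by
  have h : ‖Complex.exp (n * ξ * I)‖ = 1 := by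
    simpa using Complex.norm_exp_ofReal_mul_I (n * ξ)
  rw [norm_smul, norm_smul, h, one_mul, Complex.norm_real,
    Real.norm_of_nonneg (inv_nonneg.2 (wt_pos _ _).le)]
  exact mul_le_of_le_one_left (norm_nonneg _) (inv_le_one_of_one_le₀ (one_le_wt s n))

lemma summable_series_term (s : ℕ) (ξ : ℝ) (g : SeqSpace) :
    Summable fun n : ℤ => (((wt s n)⁻¹ : ℝ) : ℂ) • Complex.exp (n * ξ * I) • g n :=
  Summable.of_norm_bounded (summable_norm_seq g) (norm_series_term_le s ξ g)

/-- The value at `ξ` of the trigonometric series represented by a sequence. -/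
def evalAt (s : ℕ) (ξ : ℝ) : SeqSpace →L[ℂ] (Fin 2 → ℂ) :=
  LinearMap.mkContinuous
    { toFun := fun g => ∑' n : ℤ, (((wt s n)⁻¹ : ℝ) : ℂ) • Complex.exp (n * ξ * I) • g n
      map_add' := fun g h => by
        rw [← (summable_series_term s ξ g).tsum_add (summable_series_term s ξ h)]
        simp only [lp.coeFn_add, Pi.add_apply, smul_add]
      map_smul' := fun c g => by
        rw [RingHom.id_apply, ← (summable_series_term s ξ g).tsum_const_smul c]
        refine tsum_congr fun n => ?_
        simp only [lp.coeFn_smul, Pi.smul_apply]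
        rw [smul_comm _ c, smul_comm _ c] }
    1 fun g => by
      rw [one_mul, norm_eq_tsum_seq]
      exact tsum_of_norm_bounded (summable_norm_seq g).hasSum (norm_series_term_le s ξ g)

lemma hasSum_evalAt (s : ℕ) (ξ : ℝ) (g : SeqSpace) :
    HasSum (fun n : ℤ => (((wt s n)⁻¹ : ℝ) : ℂ) • Complex.exp (n * ξ * I) • g n) (evalAt s ξ g) :=
  (summable_series_term s ξ g).hasSum

lemma evalAt_shiftMap (s : ℕ) (ξ : ℝ) (j : ℤ) (A : (Fin 2 → ℂ) →L[ℂ] (Fin 2 → ℂ)) (g : SeqSpace) :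
    evalAt s ξ (shiftMap s j A g) = Complex.exp (j * ξ * I) • A (evalAt s ξ g) := by
  have h := ((hasSum_evalAt s ξ g).mapL A).const_smul (Complex.exp (j * ξ * I))
  rw [← (Equiv.subRight j).hasSum_iff] at h
  refine (hasSum_evalAt s ξ _).unique (h.congr_fun ?_)
  intro n
  have hn : ((wt s n : ℝ) : ℂ) ≠ 0 := by exact_mod_cast (wt_pos s n).ne'
  have he : Complex.exp (n * ξ * I) =
      Complex.exp (j * ξ * I) * Complex.exp (((n - j : ℤ) : ℂ) * ξ * I) := by
    rw [← Complex.exp_add]; congr 1; push_cast; ring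
  simp only [Function.comp, Equiv.subRight_apply, shiftMap_apply, map_smul, smul_smul, he]
  congr 1
  push_cast
  field_simp

lemma continuous_evalAt (s : ℕ) (g : SeqSpace) : Continuous fun ξ => evalAt s ξ g := by
  have h : (fun ξ => evalAt s ξ g) =
      fun ξ : ℝ => ∑' n : ℤ, (((wt s n)⁻¹ : ℝ) : ℂ) • Complex.exp (n * ξ * I) • g n :=
    funext fun ξ => (hasSum_evalAt s ξ g).tsum_eq.symm
  rw [h]
  exact continuous_tsum (fun n => by fun_prop) (summable_norm_seq g) fun n ξ => norm_series_term_le s ξ g n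

lemma periodic_evalAt (s : ℕ) (g : SeqSpace) :
    Function.Periodic (fun ξ => evalAt s ξ g) (2 * Real.pi) := by
  intro ξ
  refine (hasSum_evalAt s _ g).unique ((hasSum_evalAt s ξ g).congr_fun fun n => ?_)
  have : Complex.exp (n * ((ξ + 2 * Real.pi : ℝ) : ℂ) * I) = Complex.exp (n * ξ * I) := by
    rw [Complex.exp_eq_exp_iff_exists_int]
    exact ⟨n, by push_cast; ring⟩
  rw [this]

lemma integral_exp_int_mul_I (n : ℤ) :
    ∫ ξ in (-Real.pi)..Real.pi, Complex.exp (n * (ξ : ℂ) * I) =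
      if n = 0 then ((2 * Real.pi : ℝ) : ℂ) else 0 := by
  split_ifs with h
  · subst h; simp; ring
  · have hc : (n : ℂ) * I ≠ 0 := mul_ne_zero (by exact_mod_cast h) I_ne_zero
    have h1 := integral_exp_mul_complex (a := -Real.pi) (b := Real.pi) hc
    have h2 : Complex.exp (n * I * (Real.pi : ℝ)) = Complex.exp (n * I * ((-Real.pi : ℝ) : ℂ)) := by
      rw [Complex.exp_eq_exp_iff_exists_int]
      exact ⟨n, by push_cast; ring⟩
    rw [h2, sub_self, zero_div] at h1
    rw [← h1]
    congr 1; ext ξ; congr 1; ring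

lemma fourier_coeff_of_hasSum (c : ℤ → ℂ) (hc : Summable fun n => ‖c n‖) (f : ℝ → ℂ)
    (hf : ∀ ξ : ℝ, HasSum (fun n : ℤ => c n * Complex.exp (n * ξ * I)) (f ξ)) (m : ℤ) :
    ((2 * Real.pi : ℝ) : ℂ)⁻¹ *
      ∫ ξ in (-Real.pi)..Real.pi, f ξ * Complex.exp (-((m : ℂ) * (ξ : ℂ) * I)) = c m := by
  let F : ℤ → C(ℝ, ℂ) := fun n => ⟨fun ξ => c n * Complex.exp (((n - m : ℤ) : ℂ) * ξ * I), by fun_prop⟩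
  have hF : ∀ n, ‖(F n).restrict (⟨Set.uIcc (-Real.pi) Real.pi, isCompact_uIcc⟩ :
      TopologicalSpace.Compacts ℝ)‖ ≤ ‖c n‖ := by
    intro n
    rw [ContinuousMap.norm_le _ (norm_nonneg _)]
    intro ξ
    have h : ‖Complex.exp (((n - m : ℤ) : ℂ) * (ξ : ℝ) * I)‖ = 1 := by
      simpa using Complex.norm_exp_ofReal_mul_I (((n - m : ℤ) : ℝ) * ξ)
    change ‖c n * Complex.exp (((n - m : ℤ) : ℂ) * (ξ : ℝ) * I)‖ ≤ _
    rw [norm_mul, h, mul_one]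
  have h1 := intervalIntegral.hasSum_intervalIntegral_of_summable_norm
    (a := -Real.pi) (b := Real.pi) (f := F) (Summable.of_nonneg_of_le (fun _ => norm_nonneg _) hF hc)
  have h2 : ∀ ξ : ℝ, ∑' n, F n ξ = f ξ * Complex.exp (-((m : ℂ) * (ξ : ℂ) * I)) := by
    intro ξ
    refine (((hf ξ).mul_right _).congr_fun fun n => ?_).tsum_eq
    change c n * Complex.exp (((n - m : ℤ) : ℂ) * ξ * I) = _
    rw [mul_assoc (c n), ← Complex.exp_add]
    congr 2; push_cast; ring
  simp only [h2] at h1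
  have h3 : ∀ n, ∫ ξ in (-Real.pi)..Real.pi, F n ξ =
      if n = m then c m * ((2 * Real.pi : ℝ) : ℂ) else 0 := by
    intro n
    change ∫ ξ in (-Real.pi)..Real.pi, c n * Complex.exp (((n - m : ℤ) : ℂ) * ξ * I) = _
    rw [intervalIntegral.integral_const_mul, integral_exp_int_mul_I]
    by_cases h : n = m
    · simp [h]
    · simp [h, sub_eq_zero]
  simp only [h3] at h1
  rw [h1.unique (hasSum_ite_eq m _)]
  have : ((2 * Real.pi : ℝ) : ℂ) ≠ 0 := by exact_mod_cast Real.two_pi_pos.ne'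
  field_simp

lemma fourier_coeff_evalAt (s : ℕ) (g : SeqSpace) (m : ℤ) (i : Fin 2) :
    ((2 * Real.pi : ℝ) : ℂ)⁻¹ * ∫ ξ in (-Real.pi)..Real.pi,
      evalAt s ξ g i * Complex.exp (-((m : ℂ) * (ξ : ℂ) * I)) = (((wt s m)⁻¹ : ℝ) : ℂ) * g m i := by
  refine fourier_coeff_of_hasSum (fun n => (((wt s n)⁻¹ : ℝ) : ℂ) * g n i) ?_ _ (fun ξ => ?_) m
  · refine Summable.of_nonneg_of_le (fun _ => norm_nonneg _) (fun n => ?_) (summable_norm_seq g)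
    refine le_trans ?_ (norm_series_term_le s 0 g n)
    simpa using norm_le_pi_norm ((((wt s n)⁻¹ : ℝ) : ℂ) • Complex.exp (n * (0 : ℝ) * I) • g n) i
  · refine ((Pi.hasSum.1 (hasSum_evalAt s ξ g)) i).congr_fun fun n => ?_
    simp only [Pi.smul_apply, smul_eq_mul]
    ring

lemma eq_of_evalAt_eq (s : ℕ) (g h : SeqSpace) (H : ∀ ξ, evalAt s ξ g = evalAt s ξ h) : g = h := by
  ext m i
  have h1 := fourier_coeff_evalAt s g m i
  simp only [H] at h1
  rw [fourier_coeff_evalAt] at h1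
  have : (((wt s m)⁻¹ : ℝ) : ℂ) ≠ 0 := by exact_mod_cast (inv_pos.2 (wt_pos s m)).ne'
  exact (mul_left_cancel₀ this h1).symm

lemma exists_mul_operator (s : ℕ) (c : ℤ → ℂ) (hc : Summable fun n => wt s n * ‖c n‖) (f : ℝ → ℂ)
    (hf : ∀ ξ : ℝ, HasSum (fun n : ℤ => c n * Complex.exp (n * ξ * I)) (f ξ))
    (A : (Fin 2 → ℂ) →L[ℂ] (Fin 2 → ℂ)) :
    ∃ M : SeqSpace →L[ℂ] SeqSpace, ∀ ξ g, evalAt s ξ (M g) = f ξ • A (evalAt s ξ g) := by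
  have hs : Summable fun j : ℤ => c j • shiftMap s j A := by
    refine Summable.of_norm_bounded (hc.mul_right ‖A‖) fun j => ?_
    rw [norm_smul]
    calc _ ≤ ‖c j‖ * (wt s j * ‖A‖) := by gcongr; exact norm_shiftMap_le s j A
      _ = _ := by ring
  refine ⟨∑' j, c j • shiftMap s j A, fun ξ g => ?_⟩
  have h1 := (hs.hasSum.mapL (ContinuousLinearMap.apply ℂ SeqSpace g)).mapL (evalAt s ξ)
  refine h1.unique (((hf ξ).smul_const (A (evalAt s ξ g))).congr_fun fun j => ?_)
  simp only [ContinuousLinearMap.apply_apply, map_smul,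
    evalAt_shiftMap, smul_smul]

lemma exists_seq_of_series (s : ℕ) (c : Fin 2 → ℤ → ℂ) (hc : ∀ i, Summable fun n => wt s n * ‖c i n‖)
    (v : ℝ → Fin 2 → ℂ)
    (hv : ∀ (i : Fin 2) (ξ : ℝ), HasSum (fun n : ℤ => c i n * Complex.exp (n * ξ * I)) (v ξ i)) :
    ∃ g : SeqSpace, ∀ ξ, evalAt s ξ g = v ξ := by
  have hm : Memℓp (fun n i => ((wt s n : ℝ) : ℂ) * c i n) 1 := by
    refine memℓp_one_iff.2 (Summable.of_nonneg_of_le (fun _ => norm_nonneg _) (fun n => ?_)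
      ((hc 0).add (hc 1)))
    have hw := (wt_pos s n).le
    refine (pi_norm_le_iff_of_nonneg (by positivity)).2 fun i => ?_
    rw [norm_mul, Complex.norm_real, Real.norm_of_nonneg hw]
    have h0 : 0 ≤ wt s n * ‖c 0 n‖ := by positivity
    have h1 : 0 ≤ wt s n * ‖c 1 n‖ := by positivity
    fin_cases i <;> simp <;> linarith
  refine ⟨⟨_, hm⟩, fun ξ => (hasSum_evalAt s ξ _).unique (Pi.hasSum.2 fun i => ?_)⟩
  refine (hv i ξ).congr_fun fun n => ?_
  have hn : ((wt s n : ℝ) : ℂ) ≠ 0 := by exact_mod_cast (wt_pos s n).ne'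
  simp only [Pi.smul_apply, smul_eq_mul]
  push_cast
  field_simp

lemma mul_integral_mul_exp_eq_integral_deriv (f : ℝ → ℂ) (hf : ContDiff ℝ 1 f)
    (hp : Function.Periodic f (2 * Real.pi)) (n : ℤ) :
    (n : ℂ) * I * ∫ ξ in (-Real.pi)..Real.pi, f ξ * Complex.exp (-((n : ℂ) * (ξ : ℂ) * I)) =
      ∫ ξ in (-Real.pi)..Real.pi, deriv f ξ * Complex.exp (-((n : ℂ) * (ξ : ℂ) * I)) := by
  have hd : ∀ ξ : ℝ, HasDerivAt (fun ξ : ℝ => Complex.exp (-((n : ℂ) * (ξ : ℂ) * I)))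
      (Complex.exp (-((n : ℂ) * (ξ : ℂ) * I)) * (-((n : ℂ) * I))) ξ := fun ξ => by
    have h : HasDerivAt (fun z : ℂ => -((n : ℂ) * z * I)) (-((n : ℂ) * I)) (ξ : ℂ) := by
      simpa using (((hasDerivAt_id (ξ : ℂ)).const_mul (n : ℂ)).mul_const I).fun_neg
    exact h.cexp.comp_ofReal
  have h := intervalIntegral.integral_mul_deriv_eq_deriv_mul (a := -Real.pi) (b := Real.pi)
    (fun ξ _ => ((hf.differentiable one_ne_zero) ξ).hasDerivAt) (fun ξ _ => hd ξ)
    ((hf.continuous_deriv le_rfl).intervalIntegrable _ _)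
    (Continuous.intervalIntegrable (by fun_prop) _ _)
  have hb : f Real.pi = f (-Real.pi) := by
    have := hp (-Real.pi)
    rw [← this]; congr 1; ring
  have he : Complex.exp (-((n : ℂ) * (Real.pi : ℂ) * I)) =
      Complex.exp (-((n : ℂ) * ((-Real.pi : ℝ) : ℂ) * I)) := by
    rw [Complex.exp_eq_exp_iff_exists_int]
    exact ⟨-n, by push_cast; ring⟩
  rw [hb, he, sub_self, zero_sub] at h
  rw [← neg_eq_iff_eq_neg, ← intervalIntegral.integral_neg] at h
  rw [← h, ← intervalIntegral.integral_const_mul]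
  congr 1; ext ξ; ring

lemma Function.Periodic.deriv_periodic {f : ℝ → ℂ} {T : ℝ} (hp : Function.Periodic f T) :
    Function.Periodic (deriv f) T := by
  intro x
  have h : (fun y => f (y + T)) = f := funext hp
  rw [← deriv_comp_add_const, h]

lemma exists_bound_pow_mul_integral_mul_exp (k : ℕ) (f : ℝ → ℂ) (hf : ContDiff ℝ k f)
    (hp : Function.Periodic f (2 * Real.pi)) :
    ∃ C : ℝ, ∀ n : ℤ, |(n : ℝ)| ^ k *
      ‖∫ ξ in (-Real.pi)..Real.pi, f ξ * Complex.exp (-((n : ℂ) * (ξ : ℂ) * I))‖ ≤ C := by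
  induction k generalizing f with
  | zero =>
    refine ⟨∫ ξ in (-Real.pi)..Real.pi, ‖f ξ‖, fun n => ?_⟩
    rw [pow_zero, one_mul]
    refine (intervalIntegral.norm_integral_le_integral_norm (by linarith [Real.pi_pos])).trans
      (le_of_eq ?_)
    congr 1; ext ξ
    have h : ‖Complex.exp (-((n : ℂ) * (ξ : ℂ) * I))‖ = 1 := by
      simpa using Complex.norm_exp_ofReal_mul_I (-(n * ξ))
    rw [norm_mul, h, mul_one]
  | succ k ih =>
    have h1 : ContDiff ℝ 1 f := hf.of_le (by exact_mod_cast Nat.le_add_left 1 k)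
    have hd : ContDiff ℝ k (deriv f) := by
      have := hf
      push_cast at this
      exact (contDiff_succ_iff_deriv.1 this).2.2
    obtain ⟨C, hC⟩ := ih (deriv f) hd hp.deriv_periodic
    refine ⟨C, fun n => (le_of_eq ?_).trans (hC n)⟩
    rw [← mul_integral_mul_exp_eq_integral_deriv f h1 hp, norm_mul, norm_mul, Complex.norm_I,
      mul_one, Complex.norm_intCast]
    ring

lemma summable_wt_mul_norm_integral (s : ℕ) (f : ℝ → ℂ) (hf : ContDiff ℝ (s + 2 : ℕ) f)
    (hp : Function.Periodic f (2 * Real.pi)) :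
    Summable fun n : ℤ => wt s n *
      ‖∫ ξ in (-Real.pi)..Real.pi, f ξ * Complex.exp (-((n : ℂ) * (ξ : ℂ) * I))‖ := by
  obtain ⟨C, hC⟩ := exists_bound_pow_mul_integral_mul_exp (s + 2) f hf hp
  have hs : Summable fun n : ℤ => 2 ^ s * C * (1 / (n : ℝ) ^ 2) :=
    (Real.summable_one_div_int_pow.2 one_lt_two).mul_left _
  refine Summable.of_norm_bounded_eventually hs ?_
  filter_upwards [(Set.finite_singleton (0 : ℤ)).compl_mem_cofinite] with n hn
  have hn1 : (1 : ℝ) ≤ |(n : ℝ)| := by exact_mod_cast Int.one_le_abs hn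
  rw [Real.norm_of_nonneg (mul_nonneg (wt_pos s n).le (norm_nonneg _)), mul_one_div,
    le_div_iff₀ (by rw [← sq_abs]; positivity)]
  have hw : wt s n ≤ 2 ^ s * |(n : ℝ)| ^ s := by
    unfold wt
    rw [← mul_pow]
    gcongr
    linarith
  calc _ ≤ (2 ^ s * |(n : ℝ)| ^ s) *
        ‖∫ ξ in (-Real.pi)..Real.pi, f ξ * Complex.exp (-((n : ℂ) * (ξ : ℂ) * I))‖ * (n : ℝ) ^ 2 := by
        gcongr
    _ = 2 ^ s * (|(n : ℝ)| ^ (s + 2) *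
        ‖∫ ξ in (-Real.pi)..Real.pi, f ξ * Complex.exp (-((n : ℂ) * (ξ : ℂ) * I))‖) := by
        rw [pow_add, sq_abs]; ring
    _ ≤ _ := by gcongr; exact hC n

lemma exists_fourier_series (s : ℕ) (f : ℝ → ℂ) (hf : ContDiff ℝ (s + 2 : ℕ) f)
    (hp : Function.Periodic f (2 * Real.pi)) :
    ∃ c : ℤ → ℂ, (Summable fun n => wt s n * ‖c n‖) ∧
      ∀ ξ : ℝ, HasSum (fun n : ℤ => c n * Complex.exp (n * ξ * I)) (f ξ) := by
  have := Fact.mk Real.two_pi_pos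
  let F : C(AddCircle (2 * Real.pi), ℂ) := ⟨hp.lift, continuous_coinduced_dom.2 hf.continuous⟩
  have hF : ∀ n, fourierCoeff F n = ((2 * Real.pi : ℝ) : ℂ)⁻¹ *
      ∫ ξ in (-Real.pi)..Real.pi, f ξ * Complex.exp (-((n : ℂ) * (ξ : ℂ) * I)) := by
    intro n
    rw [fourierCoeff_eq_intervalIntegral _ n (-Real.pi), show -Real.pi + 2 * Real.pi = Real.pi by ring,
      Complex.real_smul]
    congr 1
    · push_cast; ring
    · congr 1; ext ξ
      rw [fourier_coe_apply, smul_eq_mul, mul_comm]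
      congr 2
      have : (Real.pi : ℂ) ≠ 0 := by exact_mod_cast Real.pi_ne_zero
      push_cast
      field_simp
  have hs : Summable fun n => wt s n * ‖fourierCoeff F n‖ := by
    refine ((summable_wt_mul_norm_integral s f hf hp).mul_left ‖((2 * Real.pi : ℝ) : ℂ)⁻¹‖).congr
      fun n => ?_
    rw [hF, norm_mul]; ring
  refine ⟨fourierCoeff F, hs, fun ξ => ?_⟩
  have h1 : Summable (fourierCoeff F) := Summable.of_norm_bounded hs fun n =>
    le_mul_of_one_le_left (norm_nonneg _) (one_le_wt s n)
  refine (has_pointwise_sum_fourier_series_of_summable h1 (ξ : AddCircle (2 * Real.pi))).congr_fun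
    fun n => ?_
  rw [fourier_coe_apply, smul_eq_mul]
  congr 2
  have : (Real.pi : ℂ) ≠ 0 := by exact_mod_cast Real.pi_ne_zero
  push_cast
  field_simp

/-- The renormalized one-step matrix `e^{iξ} ρ(a)⁻¹ [[e^{-i(l-t)}, a], [conj a, e^{i(l-t)}]]`. -/
def stepMat (a : ℂ) (t l ξ : ℝ) : Matrix (Fin 2) (Fin 2) ℂ :=
  ((rho a : ℝ) : ℂ)⁻¹ •
    !![Complex.exp (ξ * I) * Complex.exp (-(l * I)) * Complex.exp (t * I), Complex.exp (ξ * I) * a;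
       Complex.exp (ξ * I) * (starRingEnd ℂ) a,
       Complex.exp (ξ * I) * Complex.exp (l * I) * Complex.exp (-(t * I))]

lemma rho_pos {a : ℂ} (ha : ‖a‖ < 1) : 0 < rho a :=
  Real.sqrt_pos.2 (by nlinarith [norm_nonneg a])

lemma rho_sq {a : ℂ} (ha : ‖a‖ < 1) : rho a ^ 2 = 1 - ‖a‖ ^ 2 :=
  Real.sq_sqrt (by nlinarith [norm_nonneg a])

lemma mul_conj_eq_one_sub_rho_sq {a : ℂ} (ha : ‖a‖ < 1) :
    a * (starRingEnd ℂ) a = 1 - ((rho a : ℝ) : ℂ) ^ 2 := by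
  rw [Complex.mul_conj, Complex.normSq_eq_norm_sq, ← Complex.ofReal_pow, rho_sq ha]
  push_cast; ring

lemma exp_add_exp_neg_eq {r l ξ : ℝ} (h : Real.cos l = r * Real.cos ξ) :
    Complex.exp (l * I) + Complex.exp (-(l * I)) =
      r * (Complex.exp (ξ * I) + Complex.exp (-(ξ * I))) := by
  have h1 : Complex.cos l = r * Complex.cos ξ := by exact_mod_cast congrArg ((↑) : ℝ → ℂ) h
  simp only [Complex.cos, neg_mul] at h1
  linear_combination 2 * h1

lemma exp_mul_exp_neg_eq_one (z : ℂ) : Complex.exp z * Complex.exp (-z) = 1 := by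
  rw [← Complex.exp_add, add_neg_cancel, Complex.exp_zero]

lemma stepMat_mul_self_sub {a : ℂ} (ha : ‖a‖ < 1) {l ξ : ℝ}
    (h : Real.cos l = rho a * Real.cos ξ) :
    stepMat a 0 l ξ * stepMat a 0 l ξ - stepMat a 0 l ξ =
      Complex.exp (2 * ξ * I) • (stepMat a 0 l ξ - 1) := by
  have hr : ((rho a : ℝ) : ℂ) ≠ 0 := by exact_mod_cast (rho_pos ha).ne'
  have h1 := exp_add_exp_neg_eq h
  have h2 := exp_mul_exp_neg_eq_one (l * I)
  have h3 := exp_mul_exp_neg_eq_one (ξ * I)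
  have h4 := mul_conj_eq_one_sub_rho_sq ha
  have h5 : Complex.exp (2 * ξ * I) = Complex.exp (ξ * I) ^ 2 := by
    rw [← Complex.exp_nat_mul]; congr 1; push_cast; ring
  simp only [stepMat, Complex.ofReal_zero, zero_mul, neg_zero, Complex.exp_zero, mul_one, h5]
  generalize Complex.exp (ξ * I) = E at *
  generalize Complex.exp (-(ξ * I)) = E' at *
  generalize Complex.exp (l * I) = X at *
  generalize Complex.exp (-(l * I)) = X' at *
  generalize ((rho a : ℝ) : ℂ) = r at *
  generalize (starRingEnd ℂ) a = b at *
  ext i j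
  fin_cases i <;> fin_cases j <;>
    simp <;> field_simp
  · linear_combination E * X' * h1 * E + E * E * h4 - E * E * h2 + r * E * X' * h3
  · linear_combination E ^ 2 * a * h1 + r * E * a * h3
  · linear_combination E ^ 2 * b * h1 + r * E * b * h3
  · linear_combination E * X * h1 * E + E * E * h4 - E * E * h2 + r * E * X * h3

lemma differentiableAt_rho_inv {a₀ : ℂ} (h : ‖a₀‖ < 1) :
    DifferentiableAt ℝ (fun a : ℂ => ((rho a : ℝ) : ℂ)⁻¹) a₀ := by
  have h1 : DifferentiableAt ℝ rho a₀ := by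
    unfold rho
    refine DifferentiableAt.sqrt ?_ (by nlinarith [norm_nonneg a₀])
    exact (differentiableAt_id.norm_sq ℝ).const_sub 1
  have h2 : DifferentiableAt ℝ (fun a : ℂ => (rho a)⁻¹) a₀ := h1.inv (rho_pos h).ne'
  simpa [Function.comp_def] using Complex.ofRealCLM.differentiableAt.comp a₀ h2

lemma summable_weight_mul_norm_sub {F : Type*} [NormedAddCommGroup F] [NormedSpace ℝ F]
    (G : ℂ × ℝ → F) (a₀ : ℂ) (hG : DifferentiableAt ℝ G (a₀, 0)) (σ : ℕ) (a : ℤ → ℂ) (t : ℤ → ℝ)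
    (hsum : Summable fun x : ℤ => (1 + |(x : ℝ)|) ^ σ * (‖a x - a₀‖ + |t x|)) :
    Summable fun x : ℤ => (1 + |(x : ℝ)|) ^ σ * ‖G (a x, t x) - G (a₀, 0)‖ := by
  have hle : ∀ x, ‖(a x, t x) - (a₀, (0 : ℝ))‖ ≤ ‖a x - a₀‖ + |t x| := fun x => by
    rw [Prod.mk_sub_mk, sub_zero, Prod.norm_mk, Real.norm_eq_abs]
    exact max_le (by linarith [abs_nonneg (t x)]) (by linarith [norm_nonneg (a x - a₀)])
  have ht : Filter.Tendsto (fun x => (a x, t x)) Filter.cofinite (nhds (a₀, 0)) := by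
    rw [tendsto_iff_norm_sub_tendsto_zero]
    refine squeeze_zero (fun _ => norm_nonneg _) (fun x => ?_) hsum.tendsto_cofinite_zero
    exact (hle x).trans (le_mul_of_one_le_left (by positivity)
      (one_le_pow₀ (by linarith [abs_nonneg (x : ℝ)])))
  refine summable_of_isBigO hsum (Asymptotics.IsBigO.mul (Asymptotics.isBigO_refl _ _) ?_)
  refine ((hG.isBigO_sub.comp_tendsto ht).norm_left).trans (Asymptotics.IsBigO.of_bound 1 ?_)
  filter_upwards with x
  rw [one_mul, Real.norm_of_nonneg (by positivity)]
  exact hle x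

lemma norm_pow_le_of_evalAt (s : ℕ) (B : SeqSpace →L[ℂ] SeqSpace)
    (hB : ∀ ξ g, evalAt s ξ (B (B g) - B g) = Complex.exp (2 * ξ * I) • evalAt s ξ (B g - g)) :
    ∃ c : ℝ, ∀ k : ℕ, ‖B ^ k‖ ≤ c * ((k : ℝ) + 1) ^ (s + 1) := by
  set J : ℕ → SeqSpace →L[ℂ] SeqSpace :=
    fun k => shiftMap s (2 * k : ℕ) (ContinuousLinearMap.id ℂ (Fin 2 → ℂ))
  have hJ : ∀ k : ℕ, ‖J k‖ ≤ 2 ^ s * ((k : ℝ) + 1) ^ s := by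
    intro k
    refine (norm_shiftMap_le _ _ _).trans ?_
    refine (mul_le_of_le_one_right (wt_pos _ _).le ContinuousLinearMap.norm_id_le).trans ?_
    rw [wt, ← mul_pow]
    gcongr
    push_cast
    rw [abs_of_nonneg (by positivity)]
    linarith
  have hdiff : ∀ (k : ℕ) (ξ : ℝ) (g : SeqSpace), evalAt s ξ ((B ^ (k + 1)) g - (B ^ k) g) =
      Complex.exp ((2 * k : ℕ) * ξ * I) • evalAt s ξ (B g - g) := by
    intro k
    induction k with
    | zero => intro ξ g; simp
    | succ k ih =>
      intro ξ g
      have h := ih ξ (B g)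
      rw [hB, smul_smul, ← Complex.exp_add] at h
      have e1 : (B ^ (k + 1 + 1)) g = (B ^ (k + 1)) (B g) := by
        rw [pow_succ B (k + 1), mul_apply_eq_comp]
      have e2 : (B ^ (k + 1)) g = (B ^ k) (B g) := by rw [pow_succ B k, mul_apply_eq_comp]
      rw [e1, e2, h]
      congr 2; push_cast; ring
  have hstep : ∀ k : ℕ, B ^ (k + 1) = B ^ k + J k * (B - 1) := by
    intro k
    ext1 g
    refine eq_of_evalAt_eq s _ _ fun ξ => ?_
    have h := hdiff k ξ g
    rw [map_sub, sub_eq_iff_eq_add'] at h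
    rw [h, _root_.add_apply, map_add, mul_apply_eq_comp, evalAt_shiftMap]
    simp
  refine ⟨1 + 2 ^ s * ‖B - 1‖, fun k => ?_⟩
  induction k with
  | zero =>
    have h1 : ‖(1 : SeqSpace →L[ℂ] SeqSpace)‖ ≤ 1 := ContinuousLinearMap.norm_id_le
    have h2 : 0 ≤ 2 ^ s * ‖B - 1‖ := by positivity
    simp only [pow_zero, Nat.cast_zero, zero_add, one_pow, mul_one]
    linarith
  | succ k ih =>
    have hk : (0 : ℝ) ≤ k := Nat.cast_nonneg k
    have hp : ((k : ℝ) + 1) ^ s ≤ ((k : ℝ) + 2) ^ s := by gcongr; norm_num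
    have h0 : 0 ≤ ‖B - 1‖ := norm_nonneg _
    calc ‖B ^ (k + 1)‖ ≤ ‖B ^ k‖ + ‖J k‖ * ‖B - 1‖ := by
          rw [hstep]; exact (norm_add_le _ _).trans (by gcongr; exact norm_mul_le _ _)
      _ ≤ (1 + 2 ^ s * ‖B - 1‖) * ((k : ℝ) + 1) ^ (s + 1) +
          2 ^ s * ((k : ℝ) + 1) ^ s * ‖B - 1‖ := by gcongr; exact hJ k
      _ ≤ (1 + 2 ^ s * ‖B - 1‖) * (((k : ℝ) + 1) ^ (s + 1) + ((k : ℝ) + 1) ^ s) := by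
          have : 0 ≤ ((k : ℝ) + 1) ^ s := by positivity
          nlinarith
      _ = (1 + 2 ^ s * ‖B - 1‖) * (((k : ℝ) + 1) ^ s * ((k : ℝ) + 2)) := by ring
      _ ≤ (1 + 2 ^ s * ‖B - 1‖) * (((k : ℝ) + 2) ^ s * ((k : ℝ) + 2)) := by gcongr
      _ = _ := by push_cast; ring

lemma contDiff_exp_ofReal_mul_I {k : ℕ} {l : ℝ → ℝ} (hl : ContDiff ℝ k l) :
    ContDiff ℝ k fun ξ => Complex.exp (l ξ * I) :=
  ((Complex.ofRealCLM.contDiff.comp hl).mul contDiff_const).cexp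

lemma exists_stepMat_operators (s : ℕ) (l : ℝ → ℝ) (hl : ContDiff ℝ (s + 2 : ℕ) l)
    (hlp : Function.Periodic l (2 * Real.pi)) :
    ∃ M₁ M₂ M₃ M₄ : SeqSpace →L[ℂ] SeqSpace, ∀ (a : ℂ) (t ξ : ℝ) (g : SeqSpace),
      evalAt s ξ ((((rho a : ℝ) : ℂ)⁻¹ • (Complex.exp (t * I) • M₁ + Complex.exp (-(t * I)) • M₂ +
        a • M₃ + (starRingEnd ℂ) a • M₄)) g) = stepMat a t (l ξ) ξ *ᵥ evalAt s ξ g := by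
  have hexp : ∀ (f : ℝ → ℝ), ContDiff ℝ (s + 2 : ℕ) f →
      Function.Periodic f (2 * Real.pi) → ∀ A : Matrix (Fin 2) (Fin 2) ℂ,
      ∃ M : SeqSpace →L[ℂ] SeqSpace, ∀ ξ g, evalAt s ξ (M g) =
        (Complex.exp (ξ * I) * Complex.exp (f ξ * I)) • (A *ᵥ evalAt s ξ g) := by
    intro f hf hfp A
    obtain ⟨c, hc, hc'⟩ := exists_fourier_series s
      (fun ξ => Complex.exp (ξ * I) * Complex.exp (f ξ * I))
      ((contDiff_exp_ofReal_mul_I contDiff_id).mul (contDiff_exp_ofReal_mul_I hf)) (fun ξ => by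
        have : Complex.exp (((ξ + 2 * Real.pi : ℝ) : ℂ) * I) = Complex.exp (ξ * I) := by
          rw [Complex.exp_eq_exp_iff_exists_int]
          exact ⟨1, by push_cast; ring⟩
        simp only [this, hfp ξ])
    obtain ⟨M, hM⟩ := exists_mul_operator s c hc _ hc' (LinearMap.toContinuousLinearMap A.mulVecLin)
    exact ⟨M, fun ξ g => by rw [hM]; simp⟩
  obtain ⟨M₁, h1⟩ := hexp (fun ξ => -l ξ) hl.neg (fun ξ => by simp only [hlp ξ]) !![1, 0; 0, 0]
  obtain ⟨M₂, h2⟩ := hexp l hl hlp !![0, 0; 0, 1]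
  obtain ⟨M₃, h3⟩ := hexp (fun _ => 0) contDiff_const (fun ξ => rfl) !![0, 1; 0, 0]
  obtain ⟨M₄, h4⟩ := hexp (fun _ => 0) contDiff_const (fun ξ => rfl) !![0, 0; 1, 0]
  refine ⟨M₁, M₂, M₃, M₄, fun a t ξ g => ?_⟩
  simp only [_root_.smul_apply, _root_.add_apply, map_smul, map_add, h1, h2, h3, h4]
  ext i
  fin_cases i <;>
    simp [stepMat, Matrix.mulVec, dotProduct, Fin.sum_univ_two] <;> ring

/-- The solution of the renormalized recursion with prescribed limit `v` at `+∞`, as a family of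
trigonometric series. -/
theorem exists_jost_series (s : ℕ) (a₀ : ℂ) (h₁ : ‖a₀‖ < 1) (l : ℝ → ℝ)
    (hl : ContDiff ℝ (s + 2 : ℕ) l) (hlp : Function.Periodic l (2 * Real.pi))
    (hcos : ∀ ξ, Real.cos (l ξ) = rho a₀ * Real.cos ξ) (v : ℝ → Fin 2 → ℂ)
    (hv : ContDiff ℝ (s + 2 : ℕ) v) (hvp : Function.Periodic v (2 * Real.pi))
    (hfix : ∀ ξ, stepMat a₀ 0 (l ξ) ξ *ᵥ v ξ = v ξ) (a : ℤ → ℂ) (t : ℤ → ℝ)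
    (hsum : Summable fun x : ℤ => (1 + |(x : ℝ)|) ^ (s + 1) * (‖a x - a₀‖ + |t x|)) :
    ∃ u : ℤ → SeqSpace,
      (∀ (ξ : ℝ) (x : ℤ),
        evalAt s ξ (u x) = stepMat (a x) (t x) (l ξ) ξ *ᵥ evalAt s ξ (u (x + 1))) ∧
      (∀ ξ, Filter.Tendsto (fun x => evalAt s ξ (u x)) Filter.atTop (nhds (v ξ))) ∧
      ∃ C : ℝ, 0 ≤ C ∧ ∀ x : ℤ, ‖u x‖ ≤ C * max 1 (-(x : ℝ)) ^ (s + 1) := by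
  obtain ⟨M₁, M₂, M₃, M₄, hM⟩ := exists_stepMat_operators s l hl hlp
  set G : ℂ × ℝ → SeqSpace →L[ℂ] SeqSpace := fun p => ((rho p.1 : ℝ) : ℂ)⁻¹ •
    (Complex.exp (p.2 * I) • M₁ + Complex.exp (-(p.2 * I)) • M₂ + p.1 • M₃ +
      (starRingEnd ℂ) p.1 • M₄) with hGdef
  have hG : ∀ (p : ℂ × ℝ) (ξ : ℝ) (g : SeqSpace),
      evalAt s ξ (G p g) = stepMat p.1 p.2 (l ξ) ξ *ᵥ evalAt s ξ g :=
    fun p ξ g => hM p.1 p.2 ξ g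
  have hGd : DifferentiableAt ℝ G (a₀, 0) := by
    have hr : DifferentiableAt ℝ (fun p : ℂ × ℝ => ((rho p.1 : ℝ) : ℂ)⁻¹) (a₀, 0) :=
      DifferentiableAt.comp (g := fun a : ℂ => ((rho a : ℝ) : ℂ)⁻¹) (a₀, (0 : ℝ))
        (differentiableAt_rho_inv h₁) differentiableAt_fst
    have ht : DifferentiableAt ℝ (fun p : ℂ × ℝ => (p.2 : ℂ) * I) (a₀, 0) :=
      (Complex.ofRealCLM.differentiableAt.comp (a₀, (0 : ℝ)) differentiableAt_snd).mul_const I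
    have hc : DifferentiableAt ℝ (fun p : ℂ × ℝ => (starRingEnd ℂ) p.1) (a₀, 0) :=
      Complex.conjCLE.differentiableAt.comp (a₀, (0 : ℝ)) differentiableAt_fst
    exact hr.smul ((((ht.cexp.smul_const M₁).add (ht.neg.cexp.smul_const M₂)).add
      (differentiableAt_fst.smul_const M₃)).add (hc.smul_const M₄))
  have hGs := summable_weight_mul_norm_sub G a₀ hGd (s + 1) a t hsum
  obtain ⟨c, hc⟩ := norm_pow_le_of_evalAt s (G (a₀, 0)) (fun ξ g => by
    have h := congrArg (· *ᵥ evalAt s ξ g) (stepMat_mul_self_sub h₁ (hcos ξ))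
    simp only [Matrix.sub_mulVec, Matrix.smul_mulVec, Matrix.one_mulVec,
      ← Matrix.mulVec_mulVec] at h
    simpa only [map_sub, hG] using h)
  have hvi : ∀ i : Fin 2, ∃ c : ℤ → ℂ, (Summable fun n => wt s n * ‖c n‖) ∧
      ∀ ξ : ℝ, HasSum (fun n : ℤ => c n * Complex.exp (n * ξ * I)) (v ξ i) := fun i =>
    exists_fourier_series s (fun ξ => v ξ i) (contDiff_pi.1 hv i) fun ξ => by simp only [hvp ξ]
  choose cv hcv hcv' using hvi
  obtain ⟨g, hg⟩ := exists_seq_of_series s cv hcv v hcv'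
  have hgfix : G (a₀, 0) g = g := eq_of_evalAt_eq s _ _ fun ξ => by rw [hG, hg, hfix]
  obtain ⟨u, hu, hut, hC⟩ := exists_solution_of_summable_perturbation (G (a₀, 0))
    (fun x => G (a x, t x) - G (a₀, 0)) g hgfix (s + 1) c hc hGs
  refine ⟨u, fun ξ x => ?_, fun ξ => ?_, hC⟩
  · have h := hu x
    rw [add_sub_cancel] at h
    rw [h, hG]
  · rw [← hg ξ]
    exact ((evalAt s ξ).continuous.tendsto g).comp hut

lemma rho_lt_one {a : ℂ} (ha : 0 < ‖a‖) : rho a < 1 := by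
  rw [rho, Real.sqrt_lt' one_pos]
  nlinarith

lemma rho_neg (a : ℂ) : rho (-a) = rho a := by simp [rho]

lemma abs_rho_mul_cos_lt_one {a : ℂ} (h₀ : 0 < ‖a‖) (ξ : ℝ) : |rho a * Real.cos ξ| < 1 := by
  have h : 0 ≤ rho a := Real.sqrt_nonneg _
  rw [abs_mul, abs_of_nonneg h]
  exact (mul_le_of_le_one_right h (Real.abs_cos_le_one ξ)).trans_lt (rho_lt_one h₀)

lemma cos_lamOf {a : ℂ} (h₀ : 0 < ‖a‖) (ξ : ℝ) : Real.cos (lamOf a ξ) = rho a * Real.cos ξ := by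
  have h := abs_lt.1 (abs_rho_mul_cos_lt_one h₀ ξ)
  exact Real.cos_arccos h.1.le h.2.le

lemma contDiff_lamOf {a : ℂ} (h₀ : 0 < ‖a‖) (k : ℕ) : ContDiff ℝ k (lamOf a) := by
  rw [contDiff_iff_contDiffAt]
  intro ξ
  have h := abs_lt.1 (abs_rho_mul_cos_lt_one h₀ ξ)
  exact (Real.contDiffAt_arccos h.1.ne' h.2.ne).comp ξ
    (contDiff_const.mul Real.contDiff_cos).contDiffAt

lemma periodic_lamOf (a : ℂ) : Function.Periodic (lamOf a) (2 * Real.pi) := fun ξ => by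
  simp [lamOf]

lemma Aco_pos {a : ℂ} (h₀ : 0 < ‖a‖) (ε ξ : ℝ) : 0 < Aco a ε ξ := by
  unfold Aco
  positivity

lemma contDiff_jvec_entry {a : ℂ} (h₀ : 0 < ‖a‖) (ε : ℝ) (k : ℕ) :
    ContDiff ℝ k fun ξ : ℝ => Complex.exp (Complex.I * (lamOf a ξ : ℂ))
      - ((rho a : ℝ) : ℂ) * Complex.exp (((ε * ξ : ℝ) : ℂ) * Complex.I) := by
  simp only [mul_comm Complex.I]
  exact (contDiff_exp_ofReal_mul_I (contDiff_lamOf h₀ k)).sub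
    (contDiff_const.mul (contDiff_exp_ofReal_mul_I (contDiff_const.mul contDiff_id)))

lemma contDiff_jvec {a : ℂ} (h₀ : 0 < ‖a‖) (ε : ℝ) (k : ℕ) : ContDiff ℝ k (jvec a ε) := by
  have hA : ContDiff ℝ k (Aco a ε) := contDiff_const.add ((contDiff_jvec_entry h₀ ε k).norm_sq ℝ)
  have hs : ContDiff ℝ k fun ξ => (((Real.sqrt (Aco a ε ξ))⁻¹ : ℝ) : ℂ) :=
    Complex.ofRealCLM.contDiff.comp ((hA.sqrt fun ξ => (Aco_pos h₀ ε ξ).ne').inv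
      fun ξ => (Real.sqrt_pos.2 (Aco_pos h₀ ε ξ)).ne')
  refine hs.smul (contDiff_pi.2 fun i => ?_)
  fin_cases i
  · exact contDiff_const
  · exact contDiff_jvec_entry h₀ ε k

lemma periodic_jvec (a : ℂ) (ε : ℝ) (hε : ε = 1 ∨ ε = -1) :
    Function.Periodic (jvec a ε) (2 * Real.pi) := fun ξ => by
  have h : Complex.exp (((ε * (ξ + 2 * Real.pi) : ℝ) : ℂ) * Complex.I) =
      Complex.exp (((ε * ξ : ℝ) : ℂ) * Complex.I) := by
    rw [Complex.exp_eq_exp_iff_exists_int]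
    rcases hε with rfl | rfl
    · exact ⟨1, by push_cast; ring⟩
    · exact ⟨-1, by push_cast; ring⟩
  simp only [jvec, Aco, h, periodic_lamOf a ξ]

lemma stepMat_neg_mulVec_jvec {a : ℂ} (h₀ : 0 < ‖a‖) (h₁ : ‖a‖ < 1) (ξ : ℝ) :
    stepMat (-a) 0 (lamOf a ξ) ξ *ᵥ jvec a 1 ξ = jvec a 1 ξ := by
  have hr : ((rho a : ℝ) : ℂ) ≠ 0 := by exact_mod_cast (rho_pos h₁).ne'
  have h1 := exp_add_exp_neg_eq (cos_lamOf h₀ ξ)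
  have h2 := exp_mul_exp_neg_eq_one (lamOf a ξ * I)
  have h3 := exp_mul_exp_neg_eq_one (ξ * I)
  have h4 := mul_conj_eq_one_sub_rho_sq h₁
  rw [jvec, Matrix.mulVec_smul]
  congr 1
  simp only [stepMat, Complex.ofReal_zero, zero_mul, neg_zero, Complex.exp_zero, mul_one, one_mul,
    rho_neg, map_neg, mul_comm I]
  generalize Complex.exp (ξ * I) = E at *
  generalize Complex.exp (-(ξ * I)) = E' at *
  generalize Complex.exp (lamOf a ξ * I) = X at *
  generalize Complex.exp (-(lamOf a ξ * I)) = X' at *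
  generalize ((rho a : ℝ) : ℂ) = r at *
  generalize (starRingEnd ℂ) a = b at *
  ext i
  fin_cases i <;> simp [Matrix.mulVec, dotProduct] <;> field_simp
  · linear_combination -E * a * h1 - r * a * h3
  · linear_combination E * h4 + E * X * h1 - E * h2 + r * X * h3

lemma stepMat_mulVec_jvec {a : ℂ} (h₀ : 0 < ‖a‖) (h₁ : ‖a‖ < 1) (ξ : ℝ) :
    stepMat a 0 (-lamOf a ξ) ξ *ᵥ jvec a (-1) ξ = jvec a (-1) ξ := by
  have hr : ((rho a : ℝ) : ℂ) ≠ 0 := by exact_mod_cast (rho_pos h₁).ne'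
  have h1 := exp_add_exp_neg_eq (cos_lamOf h₀ ξ)
  have h2 := exp_mul_exp_neg_eq_one (lamOf a ξ * I)
  have h3 := exp_mul_exp_neg_eq_one (ξ * I)
  have h4 := mul_conj_eq_one_sub_rho_sq h₁
  rw [jvec, Matrix.mulVec_smul]
  congr 1
  simp only [stepMat, Complex.ofReal_zero, zero_mul, neg_zero, Complex.exp_zero, mul_one, one_mul,
    Complex.ofReal_neg, neg_mul, neg_neg, mul_comm I]
  generalize Complex.exp (ξ * I) = E at *
  generalize Complex.exp (-(ξ * I)) = E' at *
  generalize Complex.exp (lamOf a ξ * I) = X at *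
  generalize Complex.exp (-(lamOf a ξ * I)) = X' at *
  generalize ((rho a : ℝ) : ℂ) = r at *
  generalize (starRingEnd ℂ) a = b at *
  ext i
  fin_cases i <;> simp [Matrix.mulVec, dotProduct] <;> field_simp
  · linear_combination -r * a * h3
  · linear_combination -E * h4 + E * h2 - r * X' * h3 - r * h1

lemma Tmat_mul_stepMat (α : ℤ → ℂ) (θ : ℤ → ℝ) (x : ℤ) (h : ‖α x‖ < 1) (l ξ : ℝ) :
    Tmat α θ l x * stepMat (-α x) (θ x) l ξ = Complex.exp (ξ * I) • 1 := by
  have hr : ((rho (α x) : ℝ) : ℂ) ≠ 0 := by exact_mod_cast (rho_pos h).ne'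
  have h2 := exp_mul_exp_neg_eq_one (l * I)
  have h3 := exp_mul_exp_neg_eq_one (θ x * I)
  have h4 := mul_conj_eq_one_sub_rho_sq h
  have e1 : Complex.exp (I * ((l : ℂ) - θ x)) = Complex.exp (l * I) * Complex.exp (-(θ x * I)) := by
    rw [← Complex.exp_add]; congr 1; ring
  have e2 : Complex.exp (-(I * ((l : ℂ) - θ x))) =
      Complex.exp (-(l * I)) * Complex.exp (θ x * I) := by
    rw [← Complex.exp_add]; congr 1; ring
  simp only [Tmat, stepMat, rho_neg, map_neg, e1, e2]
  generalize Complex.exp (ξ * I) = E at *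
  generalize Complex.exp (θ x * I) = Y at *
  generalize Complex.exp (-(θ x * I)) = Y' at *
  generalize Complex.exp (l * I) = X at *
  generalize Complex.exp (-(l * I)) = X' at *
  generalize ((rho (α x) : ℝ) : ℂ) = r at *
  generalize (starRingEnd ℂ) (α x) = b at *
  generalize α x = a at *
  ext i j
  fin_cases i <;> fin_cases j <;> simp <;> field_simp
  · linear_combination E * (Y * Y' * h2 + h3 - h4)
  · ring
  · ring
  · linear_combination E * (Y * Y' * h2 + h3 - h4)

lemma stepMat_neg_eq_smul_Tmat (α : ℤ → ℂ) (θ : ℤ → ℝ) (x : ℤ) (l ξ : ℝ) :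
    stepMat (α x) (-θ x) (-l) ξ = Complex.exp (ξ * I) • Tmat α θ l x := by
  have e1 : Complex.exp (I * ((l : ℂ) - θ x)) = Complex.exp (l * I) * Complex.exp (-(θ x * I)) := by
    rw [← Complex.exp_add]; congr 1; ring
  have e2 : Complex.exp (-(I * ((l : ℂ) - θ x))) =
      Complex.exp (-(l * I)) * Complex.exp (θ x * I) := by
    rw [← Complex.exp_add]; congr 1; ring
  simp only [Tmat, stepMat, e1, e2, Complex.ofReal_neg, neg_mul, neg_neg]
  ext i j
  fin_cases i <;> fin_cases j <;> simp <;> ring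

lemma jp_pos (n : ℤ) : 0 < jp n := Real.sqrt_pos.2 (by positivity)

lemma jp_le (n : ℤ) : jp n ≤ 1 + |(n : ℝ)| := by
  rw [jp, Real.sqrt_le_left (by positivity)]
  nlinarith [abs_nonneg (n : ℝ), sq_abs (n : ℝ)]

lemma one_add_abs_le_two_mul_jp (n : ℤ) : 1 + |(n : ℝ)| ≤ 2 * jp n := by
  have h1 : 1 ≤ jp n := Real.one_le_sqrt.2 (by nlinarith [sq_nonneg (n : ℝ)])
  have h2 : |(n : ℝ)| ≤ jp n := Real.abs_le_sqrt (by linarith)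
  linarith

lemma nrm2_le_two_mul_norm (v : Fin 2 → ℂ) : nrm2 v ≤ 2 * ‖v‖ := by
  have h0 := norm_le_pi_norm v 0
  have h1 := norm_le_pi_norm v 1
  rw [nrm2, Real.sqrt_le_left (by positivity)]
  nlinarith [norm_nonneg (v 0), norm_nonneg (v 1)]

lemma summable_and_tsum_nrm2_fcoefV_le (s : ℕ) (g : SeqSpace) :
    (Summable fun n : ℤ => jp n ^ s * nrm2 (fcoefV (fun ξ => evalAt s ξ g) n)) ∧
      ∑' n : ℤ, jp n ^ s * nrm2 (fcoefV (fun ξ => evalAt s ξ g) n) ≤ 2 * ‖g‖ := by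
  have hterm : ∀ n : ℤ, jp n ^ s * nrm2 (fcoefV (fun ξ => evalAt s ξ g) n) ≤ 2 * ‖g n‖ := by
    intro n
    have hf : fcoefV (fun ξ => evalAt s ξ g) n = ((wt s n : ℝ) : ℂ)⁻¹ • g n := by
      ext i
      rw [fcoefV, fourier_coeff_evalAt]
      simp
    have hw := wt_pos s n
    have hj : jp n ^ s ≤ wt s n := pow_le_pow_left₀ (jp_pos n).le (jp_le n) s
    calc jp n ^ s * nrm2 (fcoefV (fun ξ => evalAt s ξ g) n)
        ≤ wt s n * (2 * ‖fcoefV (fun ξ => evalAt s ξ g) n‖) :=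
          mul_le_mul hj (nrm2_le_two_mul_norm _) (Real.sqrt_nonneg _) hw.le
      _ = 2 * ‖g n‖ := by
          rw [hf, norm_smul, norm_inv, Complex.norm_real, Real.norm_of_nonneg hw.le]
          field_simp
  have h0 : ∀ n : ℤ, 0 ≤ jp n ^ s * nrm2 (fcoefV (fun ξ => evalAt s ξ g) n) := fun n =>
    mul_nonneg (pow_nonneg (jp_pos n).le s) (Real.sqrt_nonneg _)
  have hg := (summable_norm_seq g).mul_left 2
  have hs := Summable.of_nonneg_of_le h0 hterm hg
  refine ⟨hs, (hs.tsum_le_tsum hterm hg).trans_eq ?_⟩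
  rw [tsum_mul_left, norm_eq_tsum_seq]

lemma summable_one_add_abs_of_jp {σ : ℕ} {f : ℤ → ℝ} (hf : ∀ x, 0 ≤ f x)
    (h : Summable fun x : ℤ => jp x ^ σ * f x) :
    Summable fun x : ℤ => (1 + |(x : ℝ)|) ^ σ * f x := by
  refine Summable.of_nonneg_of_le (fun x => mul_nonneg (by positivity) (hf x)) (fun x => ?_)
    (h.mul_left (2 ^ σ))
  rw [← mul_assoc, ← mul_pow]
  exact mul_le_mul_of_nonneg_right
    (pow_le_pow_left₀ (by positivity) (one_add_abs_le_two_mul_jp x) σ) (hf x)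

lemma summable_one_add_abs_reflect {σ : ℕ} {f : ℤ → ℝ} (hf : ∀ x, 0 ≤ f x)
    (h : Summable fun x : ℤ => (1 + |(x : ℝ)|) ^ σ * f x) :
    Summable fun x : ℤ => (1 + |(x : ℝ)|) ^ σ * f (-x - 1) := by
  have hinj : Function.Injective fun x : ℤ => -x - 1 := fun x y hxy => by
    simp only at hxy; omega
  refine Summable.of_nonneg_of_le (fun x => mul_nonneg (by positivity) (hf _)) (fun x => ?_)
    ((h.comp_injective hinj).mul_left (2 ^ σ))
  simp only [Function.comp_apply]
  rw [← mul_assoc, ← mul_pow]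
  refine mul_le_mul_of_nonneg_right (pow_le_pow_left₀ (by positivity) ?_ σ) (hf _)
  push_cast
  have h1 : |(x : ℝ)| ≤ |-(x : ℝ) - 1| + 1 := by
    have := abs_add_le (-(x : ℝ) - 1) 1
    simpa using this
  linarith [abs_nonneg (-(x : ℝ) - 1)]

/-- under an `l^{1,σ}` perturbation (`σ = 1, 2`), Jost solutions exist for
all `ξ ∈ ℝ` and can be chosen so that `ξ ↦ m_±(x,ξ) = e^{∓iξx}φ_±(x,ξ)` is continuous and
2π-periodic with `Σ_n ⟨n⟩^{σ−1}‖m̂_±(x,n)‖ ≤ C·max(1, ∓x)^σ` uniformly in `x`. -/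
theorem stmt14 (σ : ℕ) (hσ : σ = 1 ∨ σ = 2)
    (α₀ : ℂ) (h₀ : 0 < ‖α₀‖) (h₁ : ‖α₀‖ < 1)
    (α : ℤ → ℂ) (θ : ℤ → ℝ) (hα : ∀ x : ℤ, ‖α x‖ < 1)
    (hsum : Summable fun x : ℤ => jp x ^ σ * (‖α x - α₀‖ + |θ x|)) :
    ∃ φp φm : ℝ → ℤ → Fin 2 → ℂ,
      (∀ ξ : ℝ, IsJostP α θ α₀ ξ (φp ξ) ∧ IsJostM α θ α₀ ξ (φm ξ)) ∧
      ∃ C : ℝ, ∀ x : ℤ,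
        (Continuous fun ξ : ℝ =>
          (fun i : Fin 2 => Complex.exp (-(((ξ * x : ℝ) : ℂ) * Complex.I)) * φp ξ x i)) ∧
        Function.Periodic (fun ξ : ℝ =>
          (fun i : Fin 2 => Complex.exp (-(((ξ * x : ℝ) : ℂ) * Complex.I)) * φp ξ x i))
          (2 * Real.pi) ∧
        Summable (fun n : ℤ => jp n ^ (σ - 1) *
          nrm2 (fcoefV (fun ξ i =>
            Complex.exp (-(((ξ * x : ℝ) : ℂ) * Complex.I)) * φp ξ x i) n)) ∧
        (∑' n : ℤ, jp n ^ (σ - 1) *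
          nrm2 (fcoefV (fun ξ i =>
            Complex.exp (-(((ξ * x : ℝ) : ℂ) * Complex.I)) * φp ξ x i) n))
          ≤ C * max 1 (-(x : ℝ)) ^ σ ∧
        (Continuous fun ξ : ℝ =>
          (fun i : Fin 2 => Complex.exp (((ξ * x : ℝ) : ℂ) * Complex.I) * φm ξ x i)) ∧
        Function.Periodic (fun ξ : ℝ =>
          (fun i : Fin 2 => Complex.exp (((ξ * x : ℝ) : ℂ) * Complex.I) * φm ξ x i))
          (2 * Real.pi) ∧
        Summable (fun n : ℤ => jp n ^ (σ - 1) *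
          nrm2 (fcoefV (fun ξ i =>
            Complex.exp (((ξ * x : ℝ) : ℂ) * Complex.I) * φm ξ x i) n)) ∧
        (∑' n : ℤ, jp n ^ (σ - 1) *
          nrm2 (fcoefV (fun ξ i =>
            Complex.exp (((ξ * x : ℝ) : ℂ) * Complex.I) * φm ξ x i) n))
          ≤ C * max 1 (x : ℝ) ^ σ := by
  obtain ⟨s, rfl⟩ : ∃ s, σ = s + 1 := ⟨σ - 1, by omega⟩
  have hw := summable_one_add_abs_of_jp (fun x => by positivity) hsum
  have hwp : Summable fun x : ℤ => (1 + |(x : ℝ)|) ^ (s + 1) * (‖-α x - -α₀‖ + |θ x|) := by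
    refine hw.congr fun x => ?_
    rw [neg_sub_neg, norm_sub_rev]
  have hwm : Summable fun x : ℤ =>
      (1 + |(x : ℝ)|) ^ (s + 1) * (‖α (-x - 1) - α₀‖ + |-θ (-x - 1)|) := by
    simp only [abs_neg]
    exact summable_one_add_abs_reflect (f := fun x => ‖α x - α₀‖ + |θ x|)
      (fun x => by positivity) hw
  obtain ⟨u, hu, hut, C₁, hC₁, huC⟩ := exists_jost_series s (-α₀) (by rwa [norm_neg]) (lamOf α₀)
    (contDiff_lamOf h₀ _) (periodic_lamOf α₀) (fun ξ => by rw [rho_neg, cos_lamOf h₀])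
    (jvec α₀ 1) (contDiff_jvec h₀ 1 _) (periodic_jvec α₀ 1 (Or.inl rfl))
    (stepMat_neg_mulVec_jvec h₀ h₁) (fun x => -α x) θ hwp
  obtain ⟨w, hw', hwt, C₂, hC₂, hwC⟩ := exists_jost_series s α₀ h₁ (fun ξ => -lamOf α₀ ξ)
    (contDiff_lamOf h₀ _).neg (fun ξ => by simp only [periodic_lamOf α₀ ξ])
    (fun ξ => by rw [Real.cos_neg, cos_lamOf h₀])
    (jvec α₀ (-1)) (contDiff_jvec h₀ (-1) _) (periodic_jvec α₀ (-1) (Or.inr rfl))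
    (stepMat_mulVec_jvec h₀ h₁) (fun x => α (-x - 1)) (fun x => -θ (-x - 1)) hwm
  set φp : ℝ → ℤ → Fin 2 → ℂ := fun ξ x =>
    Complex.exp (((ξ * x : ℝ) : ℂ) * Complex.I) • evalAt s ξ (u x) with hφp
  set φm : ℝ → ℤ → Fin 2 → ℂ := fun ξ x =>
    Complex.exp (-(((ξ * x : ℝ) : ℂ) * Complex.I)) • evalAt s ξ (w (-x)) with hφm
  have hmp : ∀ (ξ : ℝ) (x : ℤ), (fun i : Fin 2 =>
      Complex.exp (-(((ξ * x : ℝ) : ℂ) * Complex.I)) * φp ξ x i) = evalAt s ξ (u x) := by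
    intro ξ x
    ext i
    simp only [hφp, Pi.smul_apply, smul_eq_mul]
    rw [← mul_assoc, mul_comm (Complex.exp _), exp_mul_exp_neg_eq_one, one_mul]
  have hmm : ∀ (ξ : ℝ) (x : ℤ), (fun i : Fin 2 =>
      Complex.exp (((ξ * x : ℝ) : ℂ) * Complex.I) * φm ξ x i) = evalAt s ξ (w (-x)) := by
    intro ξ x
    ext i
    simp only [hφm, Pi.smul_apply, smul_eq_mul]
    rw [← mul_assoc, exp_mul_exp_neg_eq_one, one_mul]
  have hrecp : ∀ (ξ : ℝ) (x : ℤ),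
      φp ξ (x + 1) = (Tmat α θ ((lamOf α₀ ξ : ℝ) : ℂ) x).mulVec (φp ξ x) := by
    intro ξ x
    simp only [hφp]
    rw [hu ξ x, Matrix.mulVec_smul, Matrix.mulVec_mulVec, Tmat_mul_stepMat α θ x (hα x),
      Matrix.smul_mulVec, Matrix.one_mulVec, smul_smul, ← Complex.exp_add]
    congr 2
    push_cast
    ring
  have hrecm : ∀ (ξ : ℝ) (x : ℤ),
      φm ξ (x + 1) = (Tmat α θ ((lamOf α₀ ξ : ℝ) : ℂ) x).mulVec (φm ξ x) := by
    intro ξ x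
    have h := hw' ξ (-(x + 1))
    rw [show -(-(x + 1)) - 1 = x by ring, show -(x + 1) + 1 = -x by ring,
      stepMat_neg_eq_smul_Tmat] at h
    simp only [hφm]
    rw [h, Matrix.mulVec_smul, Matrix.smul_mulVec, smul_smul, ← Complex.exp_add]
    congr 2
    push_cast
    ring
  refine ⟨φp, φm, fun ξ => ⟨⟨hrecp ξ, ?_⟩, ⟨hrecm ξ, ?_⟩⟩, 2 * C₁ + 2 * C₂, fun x => ?_⟩
  · rw [funext (hmp ξ)]
    exact hut ξ
  · rw [funext (hmm ξ)]
    exact (hwt ξ).comp Filter.tendsto_neg_atBot_atTop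
  · have hp := summable_and_tsum_nrm2_fcoefV_le s (u x)
    have hm := summable_and_tsum_nrm2_fcoefV_le s (w (-x))
    have hux := huC x
    have hwx := hwC (-x)
    rw [Int.cast_neg, neg_neg] at hwx
    have h1 : 0 ≤ max 1 (-(x : ℝ)) ^ (s + 1) := by positivity
    have h2 : 0 ≤ max 1 (x : ℝ) ^ (s + 1) := by positivity
    rw [funext fun ξ => hmp ξ x, funext fun ξ => hmm ξ x, Nat.add_sub_cancel]
    exact ⟨continuous_evalAt s _, periodic_evalAt s _, hp.1, by nlinarith [hp.2],
      continuous_evalAt s _, periodic_evalAt s _, hm.1, by nlinarith [hm.2]⟩
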